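/- arXiv:1105.4362 — 8 statements merged into one kernel-verified Lean document; each statement's English description precedes it below -/
import Mathlib

section
/- Let α, β be real numbers and let w = (u,v) : ℝ² → ℝ² be twice continuously differentiable on an open set containing p. Then 4 · ∂_z(∂_z̄ w)(p) = ( ∂ₓₓu(p) + α ∂_yy u(p) − αβ ∂_yy v(p) , ∂ₓₓv(p) + β ∂_yy u(p) + (α − β²) ∂_yy v(p) ). In particular the system ∂_z ∂_z̄ w = 0 is uncoupled in u and v if β = 0. -/
/-- The product on ℝ² induced by the structure polynomial X² + βX + α. -/
def cmul (α β : ℝ) (z w : ℝ × ℝ) : ℝ × ℝ :=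
  (z.1 * w.1 - α * (z.2 * w.2), z.1 * w.2 + w.1 * z.2 - β * (z.2 * w.2))

/-- The generalized Cauchy–Riemann operator ∂_z̄ w = (1/2)(∂ₓw + i ⊛ ∂_y w). -/
noncomputable def dzbar (α β : ℝ) (w : ℝ × ℝ → ℝ × ℝ) (p : ℝ × ℝ) : ℝ × ℝ :=
  (1 / 2 : ℝ) • (fderiv ℝ w p (1, 0) + cmul α β (0, 1) (fderiv ℝ w p (0, 1)))

/-- The conjugate Cauchy–Riemann operator ∂_z w = (1/2)(∂ₓw − i ⊛ ∂_y w). -/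
noncomputable def dzc (α β : ℝ) (w : ℝ × ℝ → ℝ × ℝ) (p : ℝ × ℝ) : ℝ × ℝ :=
  (1 / 2 : ℝ) • (fderiv ℝ w p (1, 0) - cmul α β (0, 1) (fderiv ℝ w p (0, 1)))

theorem four_dz_dzbar (α β : ℝ) (w : ℝ × ℝ → ℝ × ℝ) (s : Set (ℝ × ℝ)) (p : ℝ × ℝ)
    (hs : IsOpen s) (hp : p ∈ s) (hw : ContDiffOn ℝ 2 w s) :
    (4 : ℝ) • dzc α β (dzbar α β w) p =
      ((fderiv ℝ (fun q => (fderiv ℝ w q (1, 0)).1) p (1, 0)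
          + α * fderiv ℝ (fun q => (fderiv ℝ w q (0, 1)).1) p (0, 1)
          - α * β * fderiv ℝ (fun q => (fderiv ℝ w q (0, 1)).2) p (0, 1),
        fderiv ℝ (fun q => (fderiv ℝ w q (1, 0)).2) p (1, 0)
          + β * fderiv ℝ (fun q => (fderiv ℝ w q (0, 1)).1) p (0, 1)
          + (α - β ^ 2) * fderiv ℝ (fun q => (fderiv ℝ w q (0, 1)).2) p (0, 1))
        : ℝ × ℝ) ∧
    (β = 0 →
      (4 : ℝ) • dzc α β (dzbar α β w) p =
        ((fderiv ℝ (fun q => (fderiv ℝ w q (1, 0)).1) p (1, 0)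
            + α * fderiv ℝ (fun q => (fderiv ℝ w q (0, 1)).1) p (0, 1),
          fderiv ℝ (fun q => (fderiv ℝ w q (1, 0)).2) p (1, 0)
            + α * fderiv ℝ (fun q => (fderiv ℝ w q (0, 1)).2) p (0, 1)) : ℝ × ℝ)) := by
  have hc : ContDiffAt ℝ 2 w p := hw.contDiffAt (hs.mem_nhds hp)
  have hd : DifferentiableAt ℝ (fderiv ℝ w) p :=
    (hc.fderiv_right (m := 1) (by norm_num)).differentiableAt (by norm_num)
  have hsym : IsSymmSndFDerivAt ℝ w p := hc.isSymmSndFDerivAt (by simp)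
  have hD := hd.hasFDerivAt
  set D := fderiv ℝ (fderiv ℝ w) p with hDdef
  have hv : ∀ e : ℝ × ℝ, HasFDerivAt (fun q => fderiv ℝ w q e) (D.flip e) p := by
    intro e
    have := hD.clm_apply (hasFDerivAt_const e p)
    rw [ContinuousLinearMap.comp_zero, zero_add] at this
    exact this
  have h1 : ∀ e x : ℝ × ℝ, fderiv ℝ (fun q => (fderiv ℝ w q e).1) p x = (D x e).1 := by
    intro e x
    rw [(hv e).fst.fderiv]; simp
  have h2 : ∀ e x : ℝ × ℝ, fderiv ℝ (fun q => (fderiv ℝ w q e).2) p x = (D x e).2 := by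
    intro e x
    rw [(hv e).snd.fderiv]; simp
  have hs' : D (0, 1) (1, 0) = D (1, 0) (0, 1) := hsym (0, 1) (1, 0)
  have hb : ∀ x : ℝ × ℝ, fderiv ℝ (dzbar α β w) p x
      = (1 / 2 : ℝ) • (D x (1, 0) + cmul α β (0, 1) (D x (0, 1))) := by
    intro x
    have ha := hv (1, 0)
    have hb := hv (0, 1)
    have key := ((ha.fst.sub (hb.snd.const_mul α)).const_mul (1 / 2 : ℝ)).prodMk
      ((ha.snd.add (hb.fst.sub (hb.snd.const_mul β))).const_mul (1 / 2 : ℝ))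
    have he : dzbar α β w = fun q =>
        ((1 / 2 : ℝ) * ((fderiv ℝ w q (1, 0)).1 - α * (fderiv ℝ w q (0, 1)).2),
         (1 / 2 : ℝ) * ((fderiv ℝ w q (1, 0)).2
          + ((fderiv ℝ w q (0, 1)).1 - β * (fderiv ℝ w q (0, 1)).2))) := by
      funext q
      ext <;> simp [dzbar, cmul] <;> ring
    have key2 := key.fderiv
    rw [he]
    refine (congrArg (fun L => L x) key2).trans ?_
    ext <;> simp [cmul] <;> ring
  have main : (4 : ℝ) • dzc α β (dzbar α β w) p =
      (((D (1, 0) (1, 0)).1 + α * (D (0, 1) (0, 1)).1 - α * β * (D (0, 1) (0, 1)).2,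
        (D (1, 0) (1, 0)).2 + β * (D (0, 1) (0, 1)).1
          + (α - β ^ 2) * (D (0, 1) (0, 1)).2) : ℝ × ℝ) := by
    unfold dzc
    rw [hb, hb, hs']
    ext <;> simp [cmul] <;> ring
  simp only [h1, h2]
  refine ⟨main, ?_⟩
  rintro rfl
  rw [main]
  ext <;> simp
end

section
/- Let α, β be real numbers and let f, g : ℝ² → ℝ² be Fréchet differentiable at a point p. Then the product rule holds for the generalized Cauchy–Riemann operator with respect to the ℂ(α,β)-product: ∂_z̄ (f ⊛ g)(p) = f(p) ⊛ ∂_z̄ g(p) + ∂_z̄ f(p) ⊛ g(p). -/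
theorem dzbar_product_rule (α β : ℝ) (f g : ℝ × ℝ → ℝ × ℝ) (p : ℝ × ℝ)
    (hf : DifferentiableAt ℝ f p) (hg : DifferentiableAt ℝ g p) :
    dzbar α β (fun q => cmul α β (f q) (g q)) p =
      cmul α β (f p) (dzbar α β g p) + cmul α β (dzbar α β f p) (g p) := by
  have h : HasFDerivAt (fun q => cmul α β (f q) (g q)) _ p :=
    ((hf.hasFDerivAt.fst.mul hg.hasFDerivAt.fst).sub
      ((hf.hasFDerivAt.snd.mul hg.hasFDerivAt.snd).const_mul α)).prodMk
    (((hf.hasFDerivAt.fst.mul hg.hasFDerivAt.snd).add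
      (hg.hasFDerivAt.fst.mul hf.hasFDerivAt.snd)).sub
      ((hf.hasFDerivAt.snd.mul hg.hasFDerivAt.snd).const_mul β))
  unfold dzbar
  rw [h.fderiv]
  ext <;> simp [cmul] <;> ring
end

section
/- Let α, β satisfy 4α − β² > 0, let Ω ⊆ ℝ² be open, z₀ ∈ Ω, and f : Ω → ℝ². For h = (h₁,h₂) ≠ 0 set h̃ = (h₂, −h₁) (which is invertible in ℂ(α,β) by ellipticity) and define the difference quotient Q(h) = (0,−1) ⊛ (f(z₀+h) − f(z₀)) ⊛ h̃⁻¹. Suppose Q(h) tends to a limit L ∈ ℝ² as h → 0 with h ≠ 0. Then: (a) the map t ↦ f(z₀ + (t,0)) is differentiable at t = 0 with derivative L, so ∂ₓf(z₀) = L; (b) the map t ↦ f(z₀ + (0,t)) is differentiable at t = 0 with derivative d satisfying L = (0,−1) ⊛ d, so ∂_y f(z₀) exists; and (c) the Cauchy–Riemann equation holds at z₀: ∂ₓf(z₀) + i ⊛ ∂_y f(z₀) = 0, where i = (0,1). -/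
/-- The quadratic form N_{α,β}(x,y) = x² − βxy + αy². -/
def Nab (α β : ℝ) (z : ℝ × ℝ) : ℝ := z.1 ^ 2 - β * z.1 * z.2 + α * z.2 ^ 2

/-- The inverse in ℂ(α,β). -/
noncomputable def cinv (α β : ℝ) (z : ℝ × ℝ) : ℝ × ℝ :=
  ((z.1 - β * z.2) / Nab α β z, -z.2 / Nab α β z)

theorem complex_derivative_consequences (α β : ℝ) (hell : 4 * α - β ^ 2 > 0)
    (Ω : Set (ℝ × ℝ)) (hΩ : IsOpen Ω) (z₀ : ℝ × ℝ) (hz₀ : z₀ ∈ Ω)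
    (f : ℝ × ℝ → ℝ × ℝ) (L : ℝ × ℝ)
    (hQ : Filter.Tendsto
      (fun h : ℝ × ℝ =>
        cmul α β (cmul α β (0, -1) (f (z₀ + h) - f z₀)) (cinv α β (h.2, -h.1)))
      (nhdsWithin 0 {(0 : ℝ × ℝ)}ᶜ) (nhds L)) :
    HasDerivAt (fun t : ℝ => f (z₀ + (t, 0))) L 0 ∧
    ∃ d : ℝ × ℝ, HasDerivAt (fun t : ℝ => f (z₀ + (0, t))) d 0 ∧
      L = cmul α β (0, -1) d ∧ L + cmul α β (0, 1) d = 0 := by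
  have hα : 0 < α := by nlinarith [sq_nonneg β]
  have hα' : α ≠ 0 := hα.ne'
  refine ⟨?_, (β * L.1 / α - L.2, L.1 / α), ?_, ?_, ?_⟩
  · rw [hasDerivAt_iff_tendsto_slope_zero]
    have h1 : Filter.Tendsto (fun t : ℝ => ((t, 0) : ℝ × ℝ)) (nhdsWithin 0 {(0 : ℝ)}ᶜ)
        (nhdsWithin 0 {(0 : ℝ × ℝ)}ᶜ) := by
      apply tendsto_nhdsWithin_of_tendsto_nhds_of_eventually_within
      · have : Continuous (fun t : ℝ => ((t, 0) : ℝ × ℝ)) := by fun_prop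
        exact (this.tendsto' 0 0 rfl).mono_left nhdsWithin_le_nhds
      · filter_upwards [self_mem_nhdsWithin] with t ht
        intro h
        exact ht (congrArg Prod.fst h)
    refine (hQ.comp h1).congr' ?_
    filter_upwards [self_mem_nhdsWithin] with t ht
    have ht : t ≠ 0 := ht
    have e : z₀ + ((0 : ℝ), (0 : ℝ)) = z₀ := add_zero z₀
    simp only [Function.comp, zero_add, e]
    generalize f (z₀ + (t, 0)) - f z₀ = D
    ext <;> simp [cmul, cinv, Nab] <;> field_simp <;> ring
  · rw [hasDerivAt_iff_tendsto_slope_zero]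
    have h1 : Filter.Tendsto (fun t : ℝ => ((0, t) : ℝ × ℝ)) (nhdsWithin 0 {(0 : ℝ)}ᶜ)
        (nhdsWithin 0 {(0 : ℝ × ℝ)}ᶜ) := by
      apply tendsto_nhdsWithin_of_tendsto_nhds_of_eventually_within
      · have : Continuous (fun t : ℝ => ((0, t) : ℝ × ℝ)) := by fun_prop
        exact (this.tendsto' 0 0 rfl).mono_left nhdsWithin_le_nhds
      · filter_upwards [self_mem_nhdsWithin] with t ht
        intro h
        exact ht (congrArg Prod.snd h)
    have hc : Continuous (fun w : ℝ × ℝ => ((β * w.1 / α - w.2, w.1 / α) : ℝ × ℝ)) := by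
      fun_prop
    refine ((hc.tendsto L).comp (hQ.comp h1)).congr' ?_
    filter_upwards [self_mem_nhdsWithin] with t ht
    have ht : t ≠ 0 := ht
    have e : z₀ + ((0 : ℝ), (0 : ℝ)) = z₀ := add_zero z₀
    simp only [Function.comp, zero_add, e]
    generalize f (z₀ + (0, t)) - f z₀ = D
    ext <;> simp [cmul, cinv, Nab] <;> field_simp <;> ring
  · ext <;> simp [cmul] <;> field_simp <;> ring
  · ext <;> simp [cmul] <;> field_simp <;> ring
end

section
/- Let α, β satisfy 4α − β² > 0, let Ω ⊆ ℝ² be open, and let f : Ω → ℝ² be holomorphic on Ω (Fréchet differentiable with ∂_z̄ f = 0 on Ω). Then at every z₀ ∈ Ω the complex derivative of f exists and equals the conjugate Cauchy–Riemann derivative: the difference quotient Q(h) = (0,−1) ⊛ (f(z₀+h) − f(z₀)) ⊛ h̃⁻¹, where h̃ = (h₂,−h₁), tends to ∂ₓf(z₀) = ∂_z f(z₀) as h → 0 with h ≠ 0. -/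
/-- Holomorphy on an open set Ω. -/
noncomputable def HoloOn (α β : ℝ) (w : ℝ × ℝ → ℝ × ℝ) (Ω : Set (ℝ × ℝ)) : Prop :=
  ∀ p ∈ Ω, DifferentiableAt ℝ w p ∧ dzbar α β w p = 0

open Filter Asymptotics Topology in
lemma aux_div (α β : ℝ) (hell : 4 * α - β ^ 2 > 0) (x : ℝ × ℝ → ℝ) (C : ℝ)
    (hx : ∀ h, |x h| ≤ C * ‖h‖) :
    (fun h : ℝ × ℝ => x h / Nab α β (h.2, -h.1)) =O[𝓝[≠] (0 : ℝ × ℝ)] (fun h => ‖h‖⁻¹) := by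
  have hα : 0 < α := by nlinarith [sq_nonneg β]
  set D := 4 * α - β ^ 2 with hD
  apply IsBigO.of_bound (C * (4 * (1 + α) / D))
  filter_upwards [self_mem_nhdsWithin] with h hh
  have hn : 0 < ‖h‖ := norm_pos_iff.mpr hh
  have key : D * ‖h‖ ^ 2 ≤ 4 * (1 + α) * Nab α β (h.2, -h.1) := by
    have e1 : D * h.1 ^ 2 ≤ 4 * Nab α β (h.2, -h.1) := by
      simp only [Nab, hD]; nlinarith [sq_nonneg (2 * h.2 + β * h.1)]
    have e2 : D * h.2 ^ 2 ≤ 4 * α * Nab α β (h.2, -h.1) := by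
      simp only [Nab, hD]; nlinarith [sq_nonneg (2 * α * h.1 + β * h.2)]
    have e3 : ‖h‖ ^ 2 ≤ h.1 ^ 2 + h.2 ^ 2 := by
      rw [Prod.norm_def, Real.norm_eq_abs, Real.norm_eq_abs]
      rcases max_cases |h.1| |h.2| with ⟨e, _⟩ | ⟨e, _⟩ <;> rw [e, sq_abs] <;>
        nlinarith [sq_nonneg h.1, sq_nonneg h.2]
    nlinarith [mul_le_mul_of_nonneg_left e3 hell.le]
  have hN : 0 < Nab α β (h.2, -h.1) := by
    have : 0 < D * ‖h‖ ^ 2 := by positivity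
    by_contra hc
    nlinarith
  have hC : 0 ≤ C := by
    have := (abs_nonneg _).trans (hx h)
    by_contra hc
    nlinarith
  rw [norm_inv, norm_norm, Real.norm_eq_abs, abs_div, abs_of_pos hN, div_le_iff₀ hN]
  refine (hx h).trans ?_
  have : C * (4 * (1 + α) / D) * ‖h‖⁻¹ * Nab α β (h.2, -h.1)
      = C * ((4 * (1 + α) * Nab α β (h.2, -h.1)) / (D * ‖h‖)) := by
    field_simp
  rw [this]
  apply mul_le_mul_of_nonneg_left _ hC
  rw [le_div_iff₀ (by positivity)]
  nlinarith

open Filter Asymptotics Topology in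
theorem complex_derivative_of_holomorphic (α β : ℝ) (hell : 4 * α - β ^ 2 > 0)
    (Ω : Set (ℝ × ℝ)) (hΩ : IsOpen Ω) (f : ℝ × ℝ → ℝ × ℝ)
    (hf : HoloOn α β f Ω) :
    ∀ z₀ ∈ Ω,
      Filter.Tendsto
        (fun h : ℝ × ℝ =>
          cmul α β (cmul α β (0, -1) (f (z₀ + h) - f z₀)) (cinv α β (h.2, -h.1)))
        (nhdsWithin 0 {(0 : ℝ × ℝ)}ᶜ) (nhds (fderiv ℝ f z₀ (1, 0))) ∧
      fderiv ℝ f z₀ (1, 0) = dzc α β f z₀ := by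
  intro z₀ hz
  obtain ⟨hd, hcr⟩ := hf z₀ hz
  have hlin : ∀ h : ℝ × ℝ, fderiv ℝ f z₀ h
      = h.1 • fderiv ℝ f z₀ (1, 0) + h.2 • fderiv ℝ f z₀ (0, 1) := by
    intro h
    rw [← map_smul, ← map_smul, ← map_add]
    congr 1
    ext <;> simp
  have ho := (hasFDerivAt_iff_isLittleO_nhds_zero.mp hd.hasFDerivAt)
  generalize hL : fderiv ℝ f z₀ = L at *
  simp only [dzbar, dzc, hL] at *
  generalize L (1, 0) = a at *
  generalize L (0, 1) = b at *
  obtain ⟨a1, a2⟩ := a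
  obtain ⟨b1, b2⟩ := b
  simp only [cmul, Prod.ext_iff, Prod.smul_mk, Prod.mk_add_mk, smul_eq_mul, Prod.fst_zero,
    Prod.snd_zero] at hcr
  obtain ⟨c1, c2⟩ := hcr
  have ha1 : a1 = α * b2 := by linarith
  have ha2 : a2 = β * b2 - b1 := by linarith
  refine ⟨?_, ?_⟩
  swap
  · simp only [cmul, Prod.ext_iff, Prod.smul_mk, Prod.mk_sub_mk, smul_eq_mul]
    constructor <;> linarith
  have ho' := ho.mono (nhdsWithin_le_nhds (s := {(0 : ℝ × ℝ)}ᶜ))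
  set r : ℝ × ℝ → ℝ × ℝ := fun h => f (z₀ + h) - f z₀ - L h with hr
  have hr1 : (fun h => (r h).1) =o[𝓝[≠] 0] (fun h : ℝ × ℝ => ‖h‖) :=
    (isBigO_fst_prod'.trans_isLittleO ho').norm_right
  have hr2 : (fun h => (r h).2) =o[𝓝[≠] 0] (fun h : ℝ × ℝ => ‖h‖) :=
    (isBigO_snd_prod'.trans_isLittleO ho').norm_right
  have hi1 : (fun h : ℝ × ℝ => (cinv α β (h.2, -h.1)).1) =O[𝓝[≠] 0] (fun h => ‖h‖⁻¹) := by
    refine aux_div α β hell (fun h => h.2 - β * -h.1) (1 + |β|) ?_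
    intro h
    have h1 : |h.1| ≤ ‖h‖ := norm_fst_le h
    have h2 : |h.2| ≤ ‖h‖ := norm_snd_le h
    calc |h.2 - β * -h.1| = |h.2 + β * h.1| := by ring_nf
      _ ≤ |h.2| + |β| * |h.1| := by rw [← abs_mul]; exact abs_add_le _ _
      _ ≤ _ := by nlinarith [abs_nonneg β]
  have hi2 : (fun h : ℝ × ℝ => (cinv α β (h.2, -h.1)).2) =O[𝓝[≠] 0] (fun h => ‖h‖⁻¹) := by
    refine aux_div α β hell (fun h => - -h.1) 1 ?_
    intro h
    have h1 : |h.1| ≤ ‖h‖ := norm_fst_le h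
    simpa using h1
  have prod : ∀ u v : ℝ × ℝ → ℝ, u =o[𝓝[≠] 0] (fun h : ℝ × ℝ => ‖h‖) →
      v =O[𝓝[≠] 0] (fun h : ℝ × ℝ => ‖h‖⁻¹) → Tendsto (fun h => u h * v h) (𝓝[≠] 0) (𝓝 0) := by
    intro u v hu hv
    rw [← isLittleO_one_iff ℝ]
    refine (hu.mul_isBigO hv).congr' EventuallyEq.rfl ?_
    filter_upwards [self_mem_nhdsWithin] with h hh
    exact mul_inv_cancel₀ (norm_ne_zero_iff.mpr hh)
  have p11 := prod _ _ hr1 hi1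
  have p12 := prod _ _ hr1 hi2
  have p21 := prod _ _ hr2 hi1
  have p22 := prod _ _ hr2 hi2
  have hNpos : ∀ h : ℝ × ℝ, h ≠ 0 → Nab α β (h.2, -h.1) ≠ 0 := by
    intro h hh h0
    apply hh
    simp only [Nab] at h0
    have e1 : h.1 ^ 2 = 0 := by
      nlinarith [sq_nonneg (2 * h.2 + β * h.1), sq_nonneg h.1]
    have e1' : h.1 = 0 := by simpa using e1
    have e2 : h.2 = 0 := by simpa [e1'] using h0
    exact Prod.ext e1' e2
  have key : ∀ h : ℝ × ℝ, h ≠ 0 →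
      (a1 + (α * ((r h).2 * (cinv α β (h.2, -h.1)).1)
          + α * ((r h).1 * (cinv α β (h.2, -h.1)).2)
          - α * β * ((r h).2 * (cinv α β (h.2, -h.1)).2)),
       a2 + (α * ((r h).2 * (cinv α β (h.2, -h.1)).2)
          - ((r h).1 * (cinv α β (h.2, -h.1)).1)
          + β * ((r h).2 * (cinv α β (h.2, -h.1)).1)
          + β * ((r h).1 * (cinv α β (h.2, -h.1)).2)
          - β ^ 2 * ((r h).2 * (cinv α β (h.2, -h.1)).2))) =
      cmul α β (cmul α β (0, -1) (f (z₀ + h) - f z₀)) (cinv α β (h.2, -h.1)) := by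
    intro h hh
    have hN := hNpos h hh
    have hsum : f (z₀ + h) - f z₀ = r h + (h.1 • (a1, a2) + h.2 • (b1, b2)) := by
      rw [← hlin h, hr]; simp
    rw [hsum]
    generalize r h = s
    obtain ⟨s1, s2⟩ := s
    obtain ⟨x, y⟩ := h
    subst ha1 ha2
    simp only [cmul, cinv, Prod.smul_mk, Prod.mk_add_mk, smul_eq_mul, Prod.mk.injEq] at hN ⊢
    generalize hM : Nab α β (y, -x) = M at *
    simp only [Nab] at hM
    constructor
    · field_simp
      rw [← hM]; ring
    · field_simp
      rw [← hM]; ring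
  refine Tendsto.congr' (f₁ := _) (by
    filter_upwards [self_mem_nhdsWithin] with h hh
    exact key h hh) ?_
  refine Tendsto.prodMk_nhds ?_ ?_
  · simpa using Tendsto.const_add a1
      (((p21.const_mul α).add (p12.const_mul α)).sub (p22.const_mul (α * β)))
  · simpa using Tendsto.const_add a2
      (((((p22.const_mul α).sub p11).add (p21.const_mul β)).add (p12.const_mul β)).sub
        (p22.const_mul (β ^ 2)))
end

section
/- (First order interior estimate) Let α, β satisfy 4α − β² > 0, and let K₁, K₂ > 0 be constants such that K₁|z|_{(α,β)} ≤ ‖z‖ ≤ K₂|z|_{(α,β)} for all z ∈ ℝ² (‖·‖ the Euclidean norm). Let Ω ⊆ ℝ² be a bounded open set, let f be holomorphic on Ω and continuous on the closure of Ω, and suppose ‖f(z)‖ ≤ M for all z ∈ Ω. Then for every ζ ∈ Ω, ‖∂ₓf(ζ)‖ ≤ (K₂ √α) / (K₁² · dist(ζ, ∂Ω)) · M, where dist(ζ, ∂Ω) is the Euclidean distance from ζ to the boundary of Ω. -/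
/-- The (α,β)-norm |z|_{(α,β)} = √(N_{α,β}(z)). -/
noncomputable def nab (α β : ℝ) (z : ℝ × ℝ) : ℝ := Real.sqrt (Nab α β z)

/-- The Euclidean norm on ℝ². -/
noncomputable def enorm2 (z : ℝ × ℝ) : ℝ := Real.sqrt (z.1 ^ 2 + z.2 ^ 2)

/-- The Euclidean distance from a point to a set in ℝ². -/
noncomputable def edist2 (ζ : ℝ × ℝ) (s : Set (ℝ × ℝ)) : ℝ :=
  sInf ((fun w => enorm2 (ζ - w)) '' s)

open Metric in
theorem cartan_aux (E : Set ℂ) (hE : IsOpen E) (hb : Bornology.IsBounded E) (h0 : (0:ℂ) ∈ E)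
    (g : ℂ → ℂ) (hg : DifferentiableOn ℂ g E) (hm : Set.MapsTo g E E) (g0 : g 0 = 0) :
    ‖deriv g 0‖ ≤ 1 := by
  obtain ⟨r, hr, hrE⟩ := Metric.isOpen_iff.1 hE 0 h0
  obtain ⟨C, hC⟩ := hb.exists_norm_le
  have hcl : closedBall (0:ℂ) (r/2) ⊆ E := (closedBall_subset_ball (by linarith)).trans hrE
  have hit : ∀ n : ℕ, DifferentiableOn ℂ (g^[n]) E := by
    intro n
    induction n with
    | zero => simpa using differentiableOn_id
    | succ n ih =>
      rw [Function.iterate_succ]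
      exact ih.comp hg hm
  have hbd : ∀ n : ℕ, ‖deriv g 0‖ ^ n ≤ C / (r/2) := by
    intro n
    have hd : HasDerivAt g (deriv g 0) 0 := (hg.differentiableAt (hE.mem_nhds h0)).hasDerivAt
    have h1 := (hd.iterate 0 g0 n).deriv
    rw [← norm_pow, ← h1]
    apply Complex.norm_deriv_le_of_forall_mem_sphere_norm_le (by linarith)
    · refine DifferentiableOn.diffContOnCl ?_
      exact (hit n).mono (closure_ball_subset_closedBall.trans hcl)
    · intro z hz
      exact hC _ (hm.iterate n (hcl (sphere_subset_closedBall hz)))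
  by_contra! hlt
  obtain ⟨n, hn⟩ := pow_unbounded_of_one_lt (C / (r/2)) hlt
  exact absurd (hbd n) (not_le.2 hn)

theorem cartan_symm (E : Set ℂ) (hE : IsOpen E) (hb : Bornology.IsBounded E) (h0 : (0:ℂ) ∈ E)
    (hconv : Convex ℝ E) (hs : ∀ z ∈ E, -z ∈ E)
    (g : ℂ → ℂ) (hg : DifferentiableOn ℂ g E) (hm : Set.MapsTo g E E) :
    ‖deriv g 0‖ ≤ 1 := by
  have hd : HasDerivAt g (deriv g 0) 0 := (hg.differentiableAt (hE.mem_nhds h0)).hasDerivAt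
  have hd2 : HasDerivAt (fun z => (1/2 : ℂ) * (g z - g (-z))) (deriv g 0) 0 := by
    have h1 : HasDerivAt (fun z : ℂ => g (-z)) (deriv g 0 * (-1)) 0 := by
      have hd' : HasDerivAt g (deriv g 0) (-(0:ℂ)) := by simpa using hd
      exact hd'.comp (0:ℂ) (hasDerivAt_neg (0:ℂ))
    have h2 := (hd.sub h1).const_mul (1/2 : ℂ)
    have h3 : deriv g 0 = (1/2 : ℂ) * (deriv g 0 - deriv g 0 * (-1)) := by ring
    rw [h3]
    exact h2
  have key := cartan_aux E hE hb h0 (fun z => (1/2 : ℂ) * (g z - g (-z))) ?_ ?_ (by simp)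
  · rwa [hd2.deriv] at key
  · have : DifferentiableOn ℂ (fun z => g (-z)) E :=
      hg.comp differentiableOn_id.neg (fun z hz => hs z hz)
    exact (hg.sub this).const_mul _
  · intro z hz
    have h1 := hm hz
    have h2 := hs _ (hm (hs z hz))
    have := hconv h1 h2 (a := 1/2) (b := 1/2) (by norm_num) (by norm_num) (by norm_num)
    convert this using 1
    simp only [Complex.real_smul]
    push_cast
    ring

theorem enorm2_eq (z : ℝ × ℝ) : enorm2 z = ‖Complex.equivRealProdCLM.symm z‖ := by
  rw [enorm2, Complex.norm_def, Complex.normSq_apply]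
  have h1 : (Complex.equivRealProdCLM.symm z).re = z.1 := rfl
  have h2 : (Complex.equivRealProdCLM.symm z).im = z.2 := rfl
  rw [h1, h2, pow_two, pow_two]

theorem norm_le_enorm2 (z : ℝ × ℝ) : ‖z‖ ≤ enorm2 z := by
  rw [Prod.norm_def, enorm2]
  refine max_le ?_ ?_
  · rw [Real.norm_eq_abs]; exact Real.abs_le_sqrt (by nlinarith [sq_nonneg z.2])
  · rw [Real.norm_eq_abs]; exact Real.abs_le_sqrt (by nlinarith [sq_nonneg z.1])

theorem edist2_pos (Ω : Set (ℝ × ℝ)) (hΩ : IsOpen Ω) (hb : Bornology.IsBounded Ω)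
    (ζ : ℝ × ℝ) (hζ : ζ ∈ Ω) : 0 < edist2 ζ (frontier Ω) := by
  have hne : (frontier Ω).Nonempty := by
    rw [nonempty_frontier_iff]
    refine ⟨⟨ζ, hζ⟩, ?_⟩
    rintro rfl
    exact NormedSpace.unbounded_univ ℝ (ℝ × ℝ) hb
  obtain ⟨r, hr, hrE⟩ := Metric.isOpen_iff.1 hΩ ζ hζ
  refine lt_of_lt_of_le hr (le_csInf (hne.image _) ?_)
  rintro _ ⟨w, hw, rfl⟩
  refine le_trans ?_ (norm_le_enorm2 _)
  by_contra! hlt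
  have : w ∈ Ω := hrE (by rwa [Metric.mem_ball, dist_comm, dist_eq_norm])
  rw [hΩ.frontier_eq] at hw
  exact hw.2 this

theorem eball_subset (Ω : Set (ℝ × ℝ)) (hΩ : IsOpen Ω)
    (ζ : ℝ × ℝ) (hζ : ζ ∈ Ω) (p : ℝ × ℝ) (hp : enorm2 p < edist2 ζ (frontier Ω)) :
    ζ + p ∈ Ω := by
  by_contra hn
  have hseg : IsPreconnected (segment ℝ ζ (ζ + p)) := (convex_segment _ _).isPreconnected
  obtain ⟨w, hw, hwf⟩ : ∃ w, w ∈ segment ℝ ζ (ζ + p) ∧ w ∈ frontier Ω := by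
    by_contra! hno
    rw [hΩ.frontier_eq] at hno
    have hcov : segment ℝ ζ (ζ + p) ⊆ Ω ∪ (closure Ω)ᶜ := by
      intro w hw
      by_cases h : w ∈ Ω
      · exact Or.inl h
      · exact Or.inr fun hc => hno w hw ⟨hc, h⟩
    obtain ⟨w, -, h1, h2⟩ := hseg Ω (closure Ω)ᶜ hΩ isClosed_closure.isOpen_compl hcov
      ⟨ζ, left_mem_segment _ _ _, hζ⟩
      ⟨ζ + p, right_mem_segment _ _ _, (hcov (right_mem_segment _ _ _)).resolve_left hn⟩
    exact h2 (subset_closure h1)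
  have h1 : edist2 ζ (frontier Ω) ≤ enorm2 (ζ - w) := by
    apply csInf_le
    · refine ⟨0, ?_⟩
      rintro _ ⟨w, _, rfl⟩
      exact Real.sqrt_nonneg _
    · exact ⟨w, hwf, rfl⟩
  rw [segment_eq_image'] at hw
  obtain ⟨t, ht, rfl⟩ := hw
  have h2 : enorm2 (ζ - (ζ + t • (ζ + p - ζ))) ≤ enorm2 p := by
    have : ζ - (ζ + t • (ζ + p - ζ)) = (-t) • p := by
      ext <;> simp
    rw [this, enorm2_eq, enorm2_eq, map_smul, norm_smul, norm_neg, Real.norm_of_nonneg ht.1]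
    exact mul_le_of_le_one_left (norm_nonneg _) ht.2
  linarith

/-- (x,y) ↦ -y + x μ -/
noncomputable def kmap (μ : ℂ) : ℝ × ℝ →L[ℝ] ℂ :=
  (ContinuousLinearMap.fst ℝ ℝ ℝ).smulRight μ - (ContinuousLinearMap.snd ℝ ℝ ℝ).smulRight (1:ℂ)

noncomputable def emap (μ : ℂ) : ℝ × ℝ →L[ℝ] ℂ :=
  (ContinuousLinearMap.fst ℝ ℝ ℝ).smulRight (1:ℂ) + (ContinuousLinearMap.snd ℝ ℝ ℝ).smulRight μ

/-- inverse of (x,y) ↦ x + y μ -/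
noncomputable def eimap (μ : ℂ) : ℂ →L[ℝ] ℝ × ℝ :=
  (Complex.reCLM - (μ.re / μ.im) • Complex.imCLM).prod ((1 / μ.im) • Complex.imCLM)

theorem kmap_apply (μ : ℂ) (p : ℝ × ℝ) : kmap μ p = p.1 * μ - p.2 := by
  simp [kmap]

theorem emap_apply (μ : ℂ) (p : ℝ × ℝ) : emap μ p = p.1 + p.2 * μ := by
  simp [emap]

theorem eimap_apply (μ : ℂ) (w : ℂ) :
    eimap μ w = (w.re - μ.re / μ.im * w.im, 1 / μ.im * w.im) := by
  simp [eimap]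

theorem emap_eimap (μ : ℂ) (hμ : μ.im ≠ 0) (w : ℂ) : emap μ (eimap μ w) = w := by
  rw [emap_apply, eimap_apply]
  apply Complex.ext
  · simp; field_simp; ring
  · simp; field_simp

theorem eimap_kmap (μ : ℂ) (hμ : μ.im ≠ 0) (p : ℝ × ℝ) :
    eimap μ (kmap μ p) = (-p.2, p.1) := by
  rw [kmap_apply, eimap_apply]
  ext
  · simp; field_simp; ring
  · simp; field_simp

theorem core (α β : ℝ) (μ : ℂ) (hμ : 0 < μ.im) (hα : (α:ℂ) * μ ^ 2 - β * μ + 1 = 0)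
    (Ω : Set (ℝ × ℝ)) (d : ℝ) (hd : 0 < d)
    (f : ℝ × ℝ → ℝ × ℝ) (hf : HoloOn α β f Ω)
    (M : ℝ) (hM : ∀ z ∈ Ω, enorm2 (f z) < M)
    (ζ : ℝ × ℝ) (hζ : ζ ∈ Ω) (hball : ∀ p, enorm2 p < d → ζ + p ∈ Ω) :
    ‖kmap μ (fderiv ℝ f ζ (1, 0))‖ ≤ M / d := by
  have hMpos : 0 < M := lt_of_le_of_lt (Real.sqrt_nonneg _) (hM ζ hζ)
  set S : ℝ × ℝ →L[ℝ] ℂ := (Complex.equivRealProdCLM.symm : ℝ × ℝ →L[ℝ] ℂ)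
  have hS : ∀ z, enorm2 z = ‖S z‖ := enorm2_eq
  set T : ℂ →L[ℝ] ℂ := S.comp (eimap μ)
  set E : Set ℂ := T ⁻¹' Metric.ball 0 d
  have hmem : ∀ w, w ∈ E ↔ enorm2 (eimap μ w) < d := by
    intro w
    rw [hS]
    simp [E, T]
  set h : ℂ → ℂ := fun w => (d / M : ℝ) • kmap μ (f (ζ + eimap μ w))
  have hder : ∀ w ∈ E, HasFDerivAt h ((d / M : ℝ) • (kmap μ).comp
      ((fderiv ℝ f (ζ + eimap μ w)).comp (eimap μ))) w := by
    intro w hw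
    have hp := hball _ ((hmem w).1 hw)
    have h1 := (hf _ hp).1.hasFDerivAt
    have h2 : HasFDerivAt (fun w => ζ + eimap μ w) (eimap μ) w :=
      (eimap μ).hasFDerivAt.const_add ζ
    exact ((kmap μ).hasFDerivAt.comp w (h1.comp w h2)).const_smul (d / M : ℝ)
  have e1 : eimap μ 1 = (1, 0) := by rw [eimap_apply]; simp
  have hI : eimap μ Complex.I = (-(μ.re / μ.im)) • ((1:ℝ), (0:ℝ)) + (1 / μ.im) • ((0:ℝ), (1:ℝ)) := by
    rw [eimap_apply]; simp
  have hdiff : ∀ w ∈ E, DifferentiableAt ℂ h w := by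
    intro w hw
    rw [differentiableAt_complex_iff_differentiableAt_real]
    refine ⟨(hder w hw).differentiableAt, ?_⟩
    rw [(hder w hw).fderiv]
    have hp := hball _ ((hmem w).1 hw)
    have hcr := (hf _ hp).2
    simp only [ContinuousLinearMap.smul_apply, ContinuousLinearMap.comp_apply, e1, hI, map_add,
      map_smul]
    rw [dzbar] at hcr
    generalize fderiv ℝ f (ζ + eimap μ w) (1, 0) = X at *
    generalize fderiv ℝ f (ζ + eimap μ w) (0, 1) = Y at *
    have hX1 : X.1 = α * Y.2 := by
      have := congrArg Prod.fst hcr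
      simp [cmul] at this
      linarith
    have hX2 : X.2 = β * Y.2 - Y.1 := by
      have := congrArg Prod.snd hcr
      simp [cmul] at this
      linarith
    have hk : kmap μ Y = μ * kmap μ X := by
      rw [kmap_apply, kmap_apply, hX1, hX2]
      push_cast
      linear_combination (-(Y.2:ℂ)) * hα
    rw [hk]
    have hμ' : (μ.im : ℂ) ≠ 0 := by exact_mod_cast hμ.ne'
    simp only [Complex.real_smul, smul_eq_mul]
    push_cast
    have : μ = μ.re + μ.im * Complex.I := (Complex.re_add_im μ).symm
    have h3 : -((μ.re:ℂ) / μ.im) + 1 / μ.im * μ = Complex.I := by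
      field_simp
      linear_combination this
    linear_combination ((d:ℂ) / M * kmap μ X) * h3
  have h0 : (0:ℂ) ∈ E := by simp [E, hd]
  have hop : IsOpen E := Metric.isOpen_ball.preimage T.continuous
  have key := cartan_symm E hop ?_ h0 ?_ ?_ h
    (fun w hw => (hdiff w hw).differentiableWithinAt) ?_
  · have h1 : deriv h 0 = (d / M : ℝ) • kmap μ (fderiv ℝ f ζ (1, 0)) := by
      have := (hdiff 0 h0).hasDerivAt.hasFDerivAt.restrictScalars ℝ
      have h2 := this.unique (hder 0 h0)
      have h3 := congrArg (fun L : ℂ →L[ℝ] ℂ => L 1) h2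
      simpa [e1] using h3
    rw [h1, norm_smul, Real.norm_of_nonneg (by positivity)] at key
    rw [le_div_iff₀ hd]
    rw [div_mul_eq_mul_div, div_le_one hMpos] at key
    linarith
  · have hsub : E ⊆ ((emap μ).comp (Complex.equivRealProdCLM : ℂ →L[ℝ] ℝ × ℝ)) ''
        Metric.ball 0 d := by
      intro w hw
      refine ⟨T w, hw, ?_⟩
      simp [T, S, emap_eimap μ hμ.ne']
    exact (Metric.isBounded_ball.image _).subset hsub
  · exact (convex_ball (0:ℂ) d).linear_preimage T.toLinearMap
  · intro z hz
    simpa [E] using hz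
  · intro w hw
    have hp := hball _ ((hmem w).1 hw)
    rw [hmem]
    have hlt := hM _ hp
    simp only [h, map_smul, eimap_kmap μ hμ.ne']
    rw [hS, map_smul, norm_smul, ← hS, Real.norm_of_nonneg (by positivity)]
    have : enorm2 (-(f (ζ + eimap μ w)).2, (f (ζ + eimap μ w)).1) = enorm2 (f (ζ + eimap μ w)) := by
      simp [enorm2, add_comm]
    rw [this, div_mul_eq_mul_div, div_lt_iff₀ hMpos]
    exact mul_lt_mul_of_pos_left hlt hd

theorem interior_estimate (α β : ℝ) (hell : 4 * α - β ^ 2 > 0)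
    (K₁ K₂ : ℝ) (hK₁ : K₁ > 0) (hK₂ : K₂ > 0)
    (hnorm : ∀ z : ℝ × ℝ, K₁ * nab α β z ≤ enorm2 z ∧ enorm2 z ≤ K₂ * nab α β z)
    (Ω : Set (ℝ × ℝ)) (hΩ : IsOpen Ω) (hb : Bornology.IsBounded Ω)
    (f : ℝ × ℝ → ℝ × ℝ) (hf : HoloOn α β f Ω)
    (hfc : ContinuousOn f (closure Ω))
    (M : ℝ) (hM : ∀ z ∈ Ω, enorm2 (f z) ≤ M) :
    ∀ ζ ∈ Ω,
      enorm2 (fderiv ℝ f ζ (1, 0))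
        ≤ K₂ * Real.sqrt α / (K₁ ^ 2 * edist2 ζ (frontier Ω)) * M := by
  intro ζ hζ
  have hα : 0 < α := by nlinarith [sq_nonneg β]
  have hd := edist2_pos Ω hΩ hb ζ hζ
  have hball := eball_subset Ω hΩ ζ hζ
  set d := edist2 ζ (frontier Ω)
  have hM0 : 0 ≤ M := (Real.sqrt_nonneg _).trans (hM ζ hζ)
  have hK1 : K₁ ≤ 1 := by
    have := (hnorm (1, 0)).1
    simpa [nab, Nab, enorm2] using this
  set s := Real.sqrt (4 * α - β ^ 2)
  have hs : 0 < s := Real.sqrt_pos.2 hell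
  have hs2 : s ^ 2 = 4 * α - β ^ 2 := Real.sq_sqrt hell.le
  set μ : ℂ := ⟨β / (2 * α), s / (2 * α)⟩
  have hμ : 0 < μ.im := by positivity
  have hroot : (α:ℂ) * μ ^ 2 - β * μ + 1 = 0 := by
    apply Complex.ext
    · simp [μ, pow_two]; field_simp; nlinarith
    · simp [μ, pow_two]; field_simp; ring
  generalize hX : fderiv ℝ f ζ (1, 0) = X
  have hk : ‖kmap μ X‖ ≤ M / d := by
    have : ∀ M' > M, ‖kmap μ X‖ * d ≤ M' := by
      intro M' hM'
      rw [← hX, ← le_div_iff₀ hd]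
      exact core α β μ hμ hroot Ω d hd f hf M' (fun z hz => (hM z hz).trans_lt hM') ζ hζ hball
    rw [le_div_iff₀ hd]
    exact le_of_forall_gt_imp_ge_of_dense this
  have hn : nab α β X = Real.sqrt α * ‖kmap μ X‖ := by
    rw [nab, Complex.norm_def, ← Real.sqrt_mul hα.le, kmap_apply, Complex.normSq_apply]
    congr 1
    simp [μ, Nab]
    field_simp
    linear_combination (-X.1 ^ 2) * hs2
  have hA : K₂ * nab α β X ≤ K₂ * (Real.sqrt α * (M / d)) := by
    rw [hn]; gcongr
  refine ((hnorm X).2.trans hA).trans ?_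
  have e : K₂ * Real.sqrt α / (K₁ ^ 2 * d) * M = (K₂ * (Real.sqrt α * (M / d))) / K₁ ^ 2 := by
    field_simp
  rw [e]
  apply le_div_self (by positivity) (by positivity)
  exact pow_le_one₀ hK₁.le hK1
end

section
/- Let α, β satisfy 4α − β² > 0. Let γ : [a,b] → ℝ² be a continuously differentiable path and let f be continuous on the image of γ. Define the path integral ∫_γ f dz̃ = ∫_a^b f(γ(t)) ⊛ (γ₂′(t), −γ₁′(t)) dt (componentwise Bochner/Riemann integral in ℝ²), where γ = (γ₁, γ₂). Then |∫_γ f dz̃|_{(α,β)} ≤ ∫_a^b |f(γ(t))|_{(α,β)} · |(γ₂′(t), −γ₁′(t))|_{(α,β)} dt, where |(γ₂′, −γ₁′)|_{(α,β)} = √(α γ₁′(t)² + β γ₁′(t)γ₂′(t) + γ₂′(t)²). -/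
/-- The embedding of ℂ(α,β) into ℂ. -/
noncomputable def embL (α β : ℝ) : ℝ × ℝ →L[ℝ] ℂ :=
  (ContinuousLinearMap.fst ℝ ℝ ℝ).smulRight (1 : ℂ) +
  (ContinuousLinearMap.snd ℝ ℝ ℝ).smulRight (⟨-β / 2, Real.sqrt (α - β ^ 2 / 4)⟩ : ℂ)

lemma nab_eq_norm (α β : ℝ) (hell : 4 * α - β ^ 2 > 0) (z : ℝ × ℝ) :
    nab α β z = ‖embL α β z‖ := by
  have hs : Real.sqrt (α - β ^ 2 / 4) ^ 2 = α - β ^ 2 / 4 := Real.sq_sqrt (by linarith)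
  rw [Complex.norm_def, nab]
  congr 1
  simp only [Nab, embL, Complex.normSq_apply, add_apply,
    ContinuousLinearMap.smulRight_apply, ContinuousLinearMap.coe_fst',
    ContinuousLinearMap.coe_snd', Complex.add_re, Complex.add_im, Complex.smul_re,
    Complex.smul_im, Complex.one_re, Complex.one_im, smul_eq_mul]
  linear_combination (-z.2 ^ 2) * hs

lemma Nab_nonneg (α β : ℝ) (hell : 4 * α - β ^ 2 > 0) (z : ℝ × ℝ) : 0 ≤ Nab α β z := by
  unfold Nab
  nlinarith [sq_nonneg (z.1 - β / 2 * z.2), mul_nonneg hell.le (sq_nonneg z.2)]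

lemma nab_cmul (α β : ℝ) (hell : 4 * α - β ^ 2 > 0) (z w : ℝ × ℝ) :
    nab α β (cmul α β z w) = nab α β z * nab α β w := by
  unfold nab
  rw [← Real.sqrt_mul (Nab_nonneg α β hell z)]
  congr 1
  simp only [Nab, cmul]
  ring

theorem path_integral_estimate (α β : ℝ) (hell : 4 * α - β ^ 2 > 0)
    (a b : ℝ) (hab : a ≤ b) (γ γ' : ℝ → ℝ × ℝ)
    (hγ : ∀ t ∈ Set.Icc a b, HasDerivAt γ (γ' t) t)
    (hγ' : ContinuousOn γ' (Set.Icc a b))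
    (f : ℝ × ℝ → ℝ × ℝ) (hf : ContinuousOn f (γ '' Set.Icc a b)) :
    nab α β (∫ t in a..b, cmul α β (f (γ t)) ((γ' t).2, -(γ' t).1))
      ≤ ∫ t in a..b, nab α β (f (γ t)) *
          Real.sqrt (α * (γ' t).1 ^ 2 + β * (γ' t).1 * (γ' t).2 + (γ' t).2 ^ 2) := by
  have hγc : ContinuousOn γ (Set.Icc a b) := fun t ht => (hγ t ht).continuousAt.continuousWithinAt
  have hfc : ContinuousOn (fun t => f (γ t)) (Set.Icc a b) :=
    hf.comp hγc (Set.mapsTo_image _ _)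
  have hc : ContinuousOn (fun t => cmul α β (f (γ t)) ((γ' t).2, -(γ' t).1)) (Set.Icc a b) := by
    unfold cmul
    have h1 := hfc.fst
    have h2 := hfc.snd
    have h3 := hγ'.fst
    have h4 := hγ'.snd
    exact ((h1.mul h4).sub (continuousOn_const.mul (h2.mul h3.neg))).prodMk
      (((h1.mul h3.neg).add (h4.mul h2)).sub (continuousOn_const.mul (h2.mul h3.neg)))
  have hi : IntervalIntegrable (fun t => cmul α β (f (γ t)) ((γ' t).2, -(γ' t).1))
      MeasureTheory.volume a b := by
    apply ContinuousOn.intervalIntegrable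
    rwa [Set.uIcc_of_le hab]
  rw [nab_eq_norm α β hell, ← ContinuousLinearMap.intervalIntegral_comp_comm _ hi]
  refine (intervalIntegral.norm_integral_le_integral_norm hab).trans (le_of_eq ?_)
  congr 1
  funext t
  rw [← nab_eq_norm α β hell, nab_cmul α β hell]
  congr 1
  unfold nab Nab
  congr 1
  ring
end

section
/- (Weierstrass-type theorem for elliptic complex numbers) Let α, β satisfy 4α − β² > 0, let Ω ⊆ ℝ² be open and connected, and let (fₙ) be a sequence of functions holomorphic on Ω that converges to a function f : Ω → ℝ², the convergence being uniform on every compact subset of Ω. Then f is holomorphic on Ω. -/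
noncomputable def phiE (β s : ℝ) (hs : s ≠ 0) : (ℝ × ℝ) ≃L[ℝ] ℂ :=
  LinearEquiv.toContinuousLinearEquiv
  { toFun := fun p => ⟨p.1 - β / 2 * p.2, s * p.2⟩
    invFun := fun z => (z.re + β / 2 * (z.im / s), z.im / s)
    map_add' := by intro p q; apply Complex.ext <;> simp <;> ring
    map_smul' := by intro c p; apply Complex.ext <;> simp <;> ring
    left_inv := by intro p; ext <;> simp <;> field_simp <;> ring
    right_inv := by intro z; apply Complex.ext <;> simp <;> field_simp }

noncomputable def psiE (β s : ℝ) (hs : s ≠ 0) : (ℝ × ℝ) ≃L[ℝ] ℂ :=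
  LinearEquiv.toContinuousLinearEquiv
  { toFun := fun p => ⟨p.2 + β / 2 * p.1, - (s * p.1)⟩
    invFun := fun z => (-(z.im / s), z.re + β / 2 * (z.im / s))
    map_add' := by intro p q; apply Complex.ext <;> simp <;> ring
    map_smul' := by intro c p; apply Complex.ext <;> simp <;> ring
    left_inv := by intro p; ext <;> simp <;> field_simp <;> ring
    right_inv := by intro z; apply Complex.ext <;> simp <;> field_simp }

theorem phiE_apply (β s : ℝ) (hs : s ≠ 0) (p : ℝ × ℝ) :
    phiE β s hs p = ⟨p.1 - β / 2 * p.2, s * p.2⟩ := rfl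

theorem psiE_symm_apply (β s : ℝ) (hs : s ≠ 0) (z : ℂ) :
    (psiE β s hs).symm z = (-(z.im / s), z.re + β / 2 * (z.im / s)) := rfl

theorem holo_iff (α β s : ℝ) (hs : s ≠ 0) (h : 4 * s ^ 2 = 4 * α - β ^ 2)
    (w : ℝ × ℝ → ℝ × ℝ) (z : ℂ) :
    (DifferentiableAt ℝ w ((psiE β s hs).symm z) ∧ dzbar α β w ((psiE β s hs).symm z) = 0) ↔
    DifferentiableAt ℂ (phiE β s hs ∘ (w ∘ (psiE β s hs).symm)) z := by
  rw [differentiableAt_complex_iff_differentiableAt_real,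
    ContinuousLinearEquiv.comp_differentiableAt_iff,
    ContinuousLinearEquiv.comp_right_differentiableAt_iff]
  refine and_congr_right fun hd => ?_
  rw [ContinuousLinearEquiv.comp_fderiv, ContinuousLinearEquiv.comp_right_fderiv]
  unfold dzbar
  generalize fderiv ℝ w ((psiE β s hs).symm z) = A at *
  have e1 : (psiE β s hs).symm 1 = (0, 1) := by rw [psiE_symm_apply]; simp
  have e2 : (psiE β s hs).symm Complex.I = (-(1 / s)) • (1, 0) + (β / 2 * (1 / s)) • (0, 1) := by
    rw [psiE_symm_apply]; simp
  simp only [ContinuousLinearMap.comp_apply, ContinuousLinearEquiv.coe_coe, e1, e2,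
    map_add, map_smul]
  generalize A (1, 0) = a
  generalize A (0, 1) = b
  obtain ⟨a1, a2⟩ := a
  obtain ⟨b1, b2⟩ := b
  have hα : α = s ^ 2 + β ^ 2 / 4 := by linarith
  subst hα
  simp only [phiE_apply, cmul, Complex.ext_iff, Prod.ext_iff]
  simp
  field_simp
  constructor
  · rintro ⟨h1, h2⟩
    constructor
    · linear_combination -h1 + 2 * β * h2
    · linear_combination -2 * h2
  · rintro ⟨h1, h2⟩
    constructor
    · linear_combination -h1 - β * h2
    · linear_combination -h2 / 2

theorem weierstrass_elliptic (α β : ℝ) (hell : 4 * α - β ^ 2 > 0)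
    (Ω : Set (ℝ × ℝ)) (hΩ : IsOpen Ω) (hconn : IsConnected Ω)
    (F : ℕ → ℝ × ℝ → ℝ × ℝ) (f : ℝ × ℝ → ℝ × ℝ)
    (hF : ∀ n, HoloOn α β (F n) Ω)
    (hconv : ∀ K ⊆ Ω, IsCompact K → TendstoUniformlyOn F f Filter.atTop K) :
    HoloOn α β f Ω := by
  obtain ⟨s, hs, h⟩ : ∃ s : ℝ, s ≠ 0 ∧ 4 * s ^ 2 = 4 * α - β ^ 2 := by
    refine ⟨√(4 * α - β ^ 2) / 2, ?_, ?_⟩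
    · have := Real.sqrt_pos.mpr hell
      positivity
    · rw [div_pow, Real.sq_sqrt hell.le]; ring
  set ψ := psiE β s hs with hψ
  set φ := phiE β s hs with hφ
  have hU : IsOpen (ψ.symm ⁻¹' Ω) := hΩ.preimage ψ.symm.continuous
  have hlim : TendstoLocallyUniformlyOn (fun n => φ ∘ (F n ∘ ψ.symm)) (φ ∘ (f ∘ ψ.symm))
      Filter.atTop (ψ.symm ⁻¹' Ω) := by
    rw [tendstoLocallyUniformlyOn_iff_forall_isCompact hU]
    intro K hK hKc
    have h1 := hconv (ψ.symm '' K) (Set.image_subset_iff.mpr hK) (hKc.image ψ.symm.continuous)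
    have h2 := (h1.comp ψ.symm).mono (Set.subset_preimage_image ψ.symm K)
    exact (φ : (ℝ × ℝ) →L[ℝ] ℂ).uniformContinuous.comp_tendstoUniformlyOn h2
  have hd := hlim.differentiableOn (Filter.Eventually.of_forall fun n z hz =>
    ((holo_iff α β s hs h (F n) z).mp (hF n _ hz)).differentiableWithinAt) hU
  intro p hp
  have hp' : ψ p ∈ ψ.symm ⁻¹' Ω := by simpa using hp
  have := (holo_iff α β s hs h f (ψ p)).mpr (hd.differentiableAt (hU.mem_nhds hp'))
  simpa [← hψ] using this
end

section
/- (Generalized Son–Tutschke lemma) Let α, β be real numbers with αβ² − 4α² ≠ 0, let Ω ⊆ ℝ² be a nonempty open set, and let A, B, C, D, E, F, G : Ω → ℝ² be continuously differentiable. For twice continuously differentiable w : Ω → ℝ², define the operator L by (Lw)(p) = A(p) ⊛ ∂_z w(p) + B(p) ⊛ conj(∂_z w(p)) + C(p) ⊛ ∂_z̄ w(p) + D(p) ⊛ conj(∂_z̄ w(p)) + E(p) ⊛ w(p) + F(p) ⊛ conj(w(p)) + G(p), where conj(x,y) = (x,−y). Then the following are equivalent: (i) L is associated to the generalized Cauchy–Riemann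 operator, i.e. for every twice continuously differentiable w : Ω → ℝ² with ∂_z̄ w = 0 on Ω one has ∂_z̄ (Lw) = 0 on Ω; (ii) B and F are identically zero on Ω, and A, E, G are holomorphic on Ω. -/
/-- Conjugation in ℂ(α,β): conj (x,y) = (x,−y). -/
def conj2 (z : ℝ × ℝ) : ℝ × ℝ := (z.1, -z.2)

/-- The operator Lw = A ⊛ ∂_z w + B ⊛ conj(∂_z w) + C ⊛ ∂_z̄ w + D ⊛ conj(∂_z̄ w)
    + E ⊛ w + F ⊛ conj w + G. -/
noncomputable def Lop (α β : ℝ) (A B C D E F G : ℝ × ℝ → ℝ × ℝ)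
    (w : ℝ × ℝ → ℝ × ℝ) (p : ℝ × ℝ) : ℝ × ℝ :=
  cmul α β (A p) (dzc α β w p) + cmul α β (B p) (conj2 (dzc α β w p)) +
  cmul α β (C p) (dzbar α β w p) + cmul α β (D p) (conj2 (dzbar α β w p)) +
  cmul α β (E p) (w p) + cmul α β (F p) (conj2 (w p)) + G p

theorem st_fderiv_cmul (α β : ℝ) {f g : ℝ × ℝ → ℝ × ℝ} {p : ℝ × ℝ}
    (hf : DifferentiableAt ℝ f p) (hg : DifferentiableAt ℝ g p) :
    DifferentiableAt ℝ (fun q => cmul α β (f q) (g q)) p ∧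
    ∀ v, fderiv ℝ (fun q => cmul α β (f q) (g q)) p v =
      cmul α β (fderiv ℝ f p v) (g p) + cmul α β (f p) (fderiv ℝ g p v) := by
  have f1 := hf.hasFDerivAt.fst
  have f2 := hf.hasFDerivAt.snd
  have g1 := hg.hasFDerivAt.fst
  have g2 := hg.hasFDerivAt.snd
  have h := ((f1.mul g1).sub ((f2.mul g2).const_mul α)).prodMk
    (((f1.mul g2).add (g1.mul f2)).sub ((f2.mul g2).const_mul β))
  have h' : HasFDerivAt (fun q => cmul α β (f q) (g q)) _ p := h
  refine ⟨h'.differentiableAt, fun v => ?_⟩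
  rw [h'.fderiv]
  ext
  · simp [cmul]; ring
  · simp [cmul]; ring

theorem st_fderiv_conj {f : ℝ × ℝ → ℝ × ℝ} {p : ℝ × ℝ}
    (hf : DifferentiableAt ℝ f p) :
    DifferentiableAt ℝ (fun q => conj2 (f q)) p ∧
    ∀ v, fderiv ℝ (fun q => conj2 (f q)) p v = conj2 (fderiv ℝ f p v) := by
  have h := hf.hasFDerivAt.fst.prodMk hf.hasFDerivAt.snd.neg
  have h' : HasFDerivAt (fun q => conj2 (f q)) _ p := h
  refine ⟨h'.differentiableAt, fun v => ?_⟩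
  rw [h'.fderiv]
  ext <;> simp [conj2]

theorem st_dzbar_mul (α β : ℝ) {f g : ℝ × ℝ → ℝ × ℝ} {p : ℝ × ℝ}
    (hf : DifferentiableAt ℝ f p) (hg : DifferentiableAt ℝ g p) :
    dzbar α β (fun q => cmul α β (f q) (g q)) p =
      cmul α β (dzbar α β f p) (g p) + cmul α β (f p) (dzbar α β g p) := by
  simp only [dzbar, (st_fderiv_cmul α β hf hg).2]
  ext
  · simp [cmul]; ring
  · simp [cmul]; ring

theorem st_dzc_mul (α β : ℝ) {f g : ℝ × ℝ → ℝ × ℝ} {p : ℝ × ℝ}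
    (hf : DifferentiableAt ℝ f p) (hg : DifferentiableAt ℝ g p) :
    dzc α β (fun q => cmul α β (f q) (g q)) p =
      cmul α β (dzc α β f p) (g p) + cmul α β (f p) (dzc α β g p) := by
  simp only [dzc, (st_fderiv_cmul α β hf hg).2]
  ext
  · simp [cmul]; ring
  · simp [cmul]; ring

theorem st_dzbar_add (α β : ℝ) {f g : ℝ × ℝ → ℝ × ℝ} {p : ℝ × ℝ}
    (hf : DifferentiableAt ℝ f p) (hg : DifferentiableAt ℝ g p) :
    dzbar α β (fun q => f q + g q) p = dzbar α β f p + dzbar α β g p := by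
  simp only [dzbar, fderiv_fun_add hf hg]
  ext
  · simp [cmul]; ring
  · simp [cmul]; ring

theorem st_dzbar_congr (α β : ℝ) {f g : ℝ × ℝ → ℝ × ℝ} {Ω : Set (ℝ × ℝ)} (hΩ : IsOpen Ω)
    (h : ∀ q ∈ Ω, f q = g q) {p : ℝ × ℝ} (hp : p ∈ Ω) : dzbar α β f p = dzbar α β g p := by
  have : f =ᶠ[nhds p] g := Filter.eventuallyEq_of_mem (hΩ.mem_nhds hp) h
  simp only [dzbar, this.fderiv_eq]

theorem st_key (α β : ℝ) {Ω : Set (ℝ × ℝ)} (hΩ : IsOpen Ω)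
    {A B C D E F G w φ : ℝ × ℝ → ℝ × ℝ} {p : ℝ × ℝ} (hp : p ∈ Ω)
    (hA : DifferentiableAt ℝ A p) (hB : DifferentiableAt ℝ B p)
    (hE : DifferentiableAt ℝ E p) (hF : DifferentiableAt ℝ F p)
    (hG : DifferentiableAt ℝ G p) (hw : DifferentiableAt ℝ w p)
    (hφ : DifferentiableAt ℝ φ p)
    (h0 : ∀ q ∈ Ω, dzbar α β w q = 0) (h1 : ∀ q ∈ Ω, dzc α β w q = φ q) :
    dzbar α β (Lop α β A B C D E F G w) p =
      (cmul α β (dzbar α β A p) (φ p) + cmul α β (A p) (dzbar α β φ p)) +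
      (cmul α β (dzbar α β B p) (conj2 (φ p)) +
        cmul α β (B p) (dzbar α β (fun q => conj2 (φ q)) p)) +
      (cmul α β (dzbar α β E p) (w p) + cmul α β (E p) (dzbar α β w p)) +
      (cmul α β (dzbar α β F p) (conj2 (w p)) +
        cmul α β (F p) (dzbar α β (fun q => conj2 (w q)) p)) + dzbar α β G p := by
  have hcw := (st_fderiv_conj hw).1
  have hcφ := (st_fderiv_conj hφ).1
  have e1 := (st_fderiv_cmul α β hA hφ).1
  have e2 := (st_fderiv_cmul α β hB hcφ).1
  have e3 := (st_fderiv_cmul α β hE hw).1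
  have e4 := (st_fderiv_cmul α β hF hcw).1
  have := st_dzbar_congr α β (f := Lop α β A B C D E F G w)
    (g := fun q => cmul α β (A q) (φ q) + cmul α β (B q) (conj2 (φ q)) +
      cmul α β (E q) (w q) + cmul α β (F q) (conj2 (w q)) + G q) hΩ (by
      intro q hq
      simp only [Lop, h0 q hq, h1 q hq]
      ext <;> simp [cmul, conj2]) hp
  rw [this, st_dzbar_add α β (((e1.fun_add e2).fun_add e3).fun_add e4) hG,
    st_dzbar_add α β ((e1.fun_add e2).fun_add e3) e4, st_dzbar_add α β (e1.fun_add e2) e3,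
    st_dzbar_add α β e1 e2, st_dzbar_mul α β hA hφ, st_dzbar_mul α β hB hcφ,
    st_dzbar_mul α β hE hw, st_dzbar_mul α β hF hcw]

theorem st_dzbar_const (α β : ℝ) (c p : ℝ × ℝ) : dzbar α β (fun _ => c) p = 0 := by
  simp [dzbar, cmul]

theorem st_dzc_const (α β : ℝ) (c p : ℝ × ℝ) : dzc α β (fun _ => c) p = 0 := by
  simp [dzc, cmul]

/-- The basic holomorphic function. -/
def stZ (p q : ℝ × ℝ) : ℝ × ℝ := (q.2 - p.2, -(q.1 - p.1))

theorem stZ_contDiff (p : ℝ × ℝ) : ContDiff ℝ 2 (stZ p) := by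
  unfold stZ; fun_prop

theorem stZ_diff (p q : ℝ × ℝ) : DifferentiableAt ℝ (stZ p) q :=
  (stZ_contDiff p).differentiable (by norm_num) q

theorem stZ_fderiv (p q v : ℝ × ℝ) : fderiv ℝ (stZ p) q v = (v.2, -v.1) := by
  have h := (((hasFDerivAt_snd (𝕜 := ℝ) (p := q)).sub_const p.2)).prodMk
    (((hasFDerivAt_fst (𝕜 := ℝ) (p := q)).sub_const p.1)).neg
  have h' : HasFDerivAt (stZ p) _ q := h
  rw [h'.fderiv]
  simp

theorem stZ_dzbar (α β : ℝ) (p q : ℝ × ℝ) : dzbar α β (stZ p) q = 0 := by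
  simp [dzbar, stZ_fderiv, cmul]

theorem stZ_dzc (α β : ℝ) (p q : ℝ × ℝ) : dzc α β (stZ p) q = (0, -1) := by
  simp only [dzc, stZ_fderiv, cmul]
  ext <;> simp <;> norm_num

theorem st_cmul_contDiff (α β : ℝ) {f g : ℝ × ℝ → ℝ × ℝ} (hf : ContDiff ℝ 2 f)
    (hg : ContDiff ℝ 2 g) : ContDiff ℝ 2 (fun q => cmul α β (f q) (g q)) := by
  unfold cmul; fun_prop

theorem st_cmul_cancel (α β : ℝ) {z w : ℝ × ℝ}
    (hw : w.1 ^ 2 - β * w.1 * w.2 + α * w.2 ^ 2 ≠ 0) (h : cmul α β z w = 0) : z = 0 := by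
  have h1 := congrArg Prod.fst h
  have h2 := congrArg Prod.snd h
  simp only [cmul, Prod.fst_zero, Prod.snd_zero] at h1 h2
  ext
  · refine (mul_eq_zero.1 (?_ : z.1 * (w.1 ^ 2 - β * w.1 * w.2 + α * w.2 ^ 2) = 0)).resolve_right hw
    linear_combination (w.1 - β * w.2) * h1 + α * w.2 * h2
  · refine (mul_eq_zero.1 (?_ : z.2 * (w.1 ^ 2 - β * w.1 * w.2 + α * w.2 ^ 2) = 0)).resolve_right hw
    linear_combination (- w.2) * h1 + w.1 * h2

/-- The second-order fact: the derivative of a holomorphic function is holomorphic. -/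
theorem st_dzc_holo (α β : ℝ) {Ω : Set (ℝ × ℝ)} (hΩ : IsOpen Ω) {w : ℝ × ℝ → ℝ × ℝ}
    (hw : ContDiffOn ℝ 2 w Ω) (h0 : ∀ q ∈ Ω, dzbar α β w q = 0) :
    (∀ q ∈ Ω, dzc α β w q = fderiv ℝ w q (1, 0)) ∧
    ∀ p ∈ Ω, DifferentiableAt ℝ (fun q => fderiv ℝ w q (1, 0)) p ∧
      dzbar α β (fun q => fderiv ℝ w q (1, 0)) p = 0 := by
  constructor
  · intro q hq
    have h := h0 q hq
    simp only [dzbar, dzc] at h ⊢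
    have h1 := congrArg Prod.fst h
    have h2 := congrArg Prod.snd h
    simp at h1 h2
    ext
    · simp; linarith
    · simp; linarith
  intro p hp
  have hwp : ContDiffAt ℝ 2 w p := hw.contDiffAt (hΩ.mem_nhds hp)
  have hd : DifferentiableAt ℝ (fderiv ℝ w) p :=
    (hwp.fderiv_right (m := 1) (by norm_num)).differentiableAt (by norm_num)
  have hsym : IsSymmSndFDerivAt ℝ w p := hwp.isSymmSndFDerivAt (by simp)
  have hv : ∀ u, DifferentiableAt ℝ (fun q => fderiv ℝ w q u) p := fun u =>
    hd.clm_apply (differentiableAt_const u)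
  have hfd : ∀ u v, fderiv ℝ (fun q => fderiv ℝ w q u) p v = fderiv ℝ (fderiv ℝ w) p v u := by
    intro u v
    rw [fderiv_clm_apply hd (differentiableAt_const u)]
    simp
  refine ⟨hv _, ?_⟩
  have hc := st_fderiv_cmul α β (differentiableAt_const ((0, 1) : ℝ × ℝ)) (hv (0, 1))
  have hz : (fun q => fderiv ℝ w q (1, 0) + cmul α β (0, 1) (fderiv ℝ w q (0, 1)))
      =ᶠ[nhds p] fun _ => 0 := by
    refine Filter.eventuallyEq_of_mem (hΩ.mem_nhds hp) fun q hq => ?_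
    have := h0 q hq
    simp only [dzbar] at this
    exact (smul_eq_zero.1 this).resolve_left (by norm_num)
  have hz' := hz.fderiv_eq (𝕜 := ℝ)
  have hz2 := congrArg (fun l : ℝ × ℝ →L[ℝ] ℝ × ℝ => l (1, 0)) hz'
  rw [fderiv_fun_add (hv _) hc.1] at hz2
  simp only [add_apply, hc.2, hfd] at hz2
  simp only [dzbar, hfd]
  rw [hsym.eq (0, 1) (1, 0)]
  have e : cmul α β (fderiv ℝ (fun _ : ℝ × ℝ => ((0, 1) : ℝ × ℝ)) p (1, 0))
      (fderiv ℝ w p (0, 1)) = 0 := by simp [cmul]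
  rw [e, zero_add] at hz2
  rw [hz2]
  simp

theorem son_tutschke_generalized (α β : ℝ) (hαβ : α * β ^ 2 - 4 * α ^ 2 ≠ 0)
    (Ω : Set (ℝ × ℝ)) (hΩ : IsOpen Ω) (hne : Ω.Nonempty)
    (A B C D E F G : ℝ × ℝ → ℝ × ℝ)
    (hA : ContDiffOn ℝ 1 A Ω) (hB : ContDiffOn ℝ 1 B Ω)
    (hC : ContDiffOn ℝ 1 C Ω) (hD : ContDiffOn ℝ 1 D Ω)
    (hE : ContDiffOn ℝ 1 E Ω) (hF : ContDiffOn ℝ 1 F Ω)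
    (hG : ContDiffOn ℝ 1 G Ω) :
    (∀ w : ℝ × ℝ → ℝ × ℝ, ContDiffOn ℝ 2 w Ω →
        (∀ p ∈ Ω, dzbar α β w p = 0) →
        ∀ p ∈ Ω, dzbar α β (Lop α β A B C D E F G w) p = 0) ↔
    ((∀ p ∈ Ω, B p = 0) ∧ (∀ p ∈ Ω, F p = 0) ∧
      HoloOn α β A Ω ∧ HoloOn α β E Ω ∧ HoloOn α β G Ω) := by

  have hα : α ≠ 0 := by rintro rfl; simp at hαβ
  have dA : ∀ p ∈ Ω, DifferentiableAt ℝ A p := fun p hp =>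
    (hA.contDiffAt (hΩ.mem_nhds hp)).differentiableAt (by norm_num)
  have dB : ∀ p ∈ Ω, DifferentiableAt ℝ B p := fun p hp =>
    (hB.contDiffAt (hΩ.mem_nhds hp)).differentiableAt (by norm_num)
  have dE : ∀ p ∈ Ω, DifferentiableAt ℝ E p := fun p hp =>
    (hE.contDiffAt (hΩ.mem_nhds hp)).differentiableAt (by norm_num)
  have dF : ∀ p ∈ Ω, DifferentiableAt ℝ F p := fun p hp =>
    (hF.contDiffAt (hΩ.mem_nhds hp)).differentiableAt (by norm_num)
  have dG : ∀ p ∈ Ω, DifferentiableAt ℝ G p := fun p hp =>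
    (hG.contDiffAt (hΩ.mem_nhds hp)).differentiableAt (by norm_num)
  have z1 : ∀ z, cmul α β 0 z = 0 := fun z => by simp [cmul]
  have z2 : ∀ z, cmul α β z 0 = 0 := fun z => by simp [cmul]
  constructor
  · intro H
    -- constants
    have hconst : ∀ c : ℝ × ℝ, ∀ p ∈ Ω, cmul α β (dzbar α β E p) c +
        cmul α β (dzbar α β F p) (conj2 c) + dzbar α β G p = 0 := by
      intro c p hp
      have h := H (fun _ => c) contDiffOn_const (fun q _ => st_dzbar_const α β c q) p hp
      rw [st_key α β hΩ hp (dA p hp) (dB p hp) (dE p hp) (dF p hp) (dG p hp)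
        (differentiableAt_const c) (differentiableAt_const (0 : ℝ × ℝ))
        (fun q _ => st_dzbar_const α β c q) (fun q _ => st_dzc_const α β c q)] at h
      simp only [st_dzbar_const] at h
      rw [← h]
      ext <;> simp [cmul, conj2]
    have hG0 : ∀ p ∈ Ω, dzbar α β G p = 0 := fun p hp => by
      have := hconst 0 p hp
      have hc : conj2 0 = 0 := by simp [conj2]
      rwa [hc, z2, z2, add_zero, zero_add] at this
    have hEF : ∀ p ∈ Ω, dzbar α β E p = 0 ∧ dzbar α β F p = 0 := by
      intro p hp
      have h1 := hconst (1, 0) p hp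
      have h2 := hconst (0, 1) p hp
      rw [hG0 p hp, add_zero] at h1 h2
      have h2' : cmul α β (dzbar α β E p - dzbar α β F p) (0, 1) = 0 := by
        rw [← h2]; ext <;> simp [cmul, conj2] <;> ring
      have h3 := st_cmul_cancel α β (by simpa using hα) h2'
      have h1' : dzbar α β E p + dzbar α β F p = 0 := by
        rw [← h1]; ext <;> simp [cmul, conj2]
      rw [sub_eq_zero] at h3
      rw [h3] at h1' ⊢
      have : dzbar α β F p = 0 := self_eq_neg.1 (eq_neg_of_add_eq_zero_left h1')
      exact ⟨this, this⟩
    have hZ0 : ∀ p, stZ p p = 0 := fun p => by simp [stZ]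
    have hlin_dzbar : ∀ k p q, dzbar α β (fun q => cmul α β k (stZ p q)) q = 0 := by
      intro k p q
      rw [st_dzbar_mul α β (differentiableAt_const k) (stZ_diff p q), st_dzbar_const, stZ_dzbar,
        z1, z2, add_zero]
    have hlin_dzc : ∀ k p q, dzc α β (fun q => cmul α β k (stZ p q)) q = cmul α β k (0, -1) := by
      intro k p q
      rw [st_dzc_mul α β (differentiableAt_const k) (stZ_diff p q), st_dzc_const, stZ_dzc,
        z1, zero_add]
    have hlin_diff : ∀ k p q, DifferentiableAt ℝ (fun q => cmul α β k (stZ p q)) q :=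
      fun k p q => (st_fderiv_cmul α β (differentiableAt_const k) (stZ_diff p q)).1
    have hlin_conj : ∀ k p q, dzbar α β (fun q => conj2 (cmul α β k (stZ p q))) q =
        (α * k.2, k.1) := by
      intro k p q
      simp only [dzbar, (st_fderiv_conj (hlin_diff k p q)).2,
        (st_fderiv_cmul α β (differentiableAt_const k) (stZ_diff p q)).2, stZ_fderiv]
      ext
      · simp [cmul, conj2]; ring
      · simp [cmul, conj2]; ring
    -- quadratic
    have hB0 : ∀ p ∈ Ω, B p = 0 := by
      intro p hp
      have hq0 : ∀ q ∈ Ω, dzbar α β (fun q => cmul α β (stZ p q) (stZ p q)) q = 0 := by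
        intro q _
        rw [st_dzbar_mul α β (stZ_diff p q) (stZ_diff p q), stZ_dzbar, z1, z2, add_zero]
      have hq1 : ∀ q ∈ Ω, dzc α β (fun q => cmul α β (stZ p q) (stZ p q)) q =
          cmul α β (0, -2) (stZ p q) := by
        intro q _
        rw [st_dzc_mul α β (stZ_diff p q) (stZ_diff p q), stZ_dzc]
        ext
        · simp [cmul]; ring
        · simp [cmul]; ring
      have hqd := (st_fderiv_cmul α β (stZ_diff p p) (stZ_diff p p))
      have h := H _ (st_cmul_contDiff α β (stZ_contDiff p) (stZ_contDiff p)).contDiffOn hq0 p hp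
      rw [st_key α β hΩ hp (dA p hp) (dB p hp) (dE p hp) (dF p hp) (dG p hp)
        hqd.1 (hlin_diff (0, -2) p p) hq0 hq1] at h
      have hc : dzbar α β (fun q => conj2 (cmul α β (stZ p q) (stZ p q))) p = 0 := by
        simp only [dzbar, (st_fderiv_conj hqd.1).2, hqd.2, hZ0]
        simp [cmul, conj2]
      rw [hc, hq0 p hp, hlin_conj, hlin_dzbar, (hEF p hp).1, (hEF p hp).2, hG0 p hp, hZ0] at h
      apply st_cmul_cancel α β (w := (α * -2, 0)) (by simpa using hα)
      rw [← h]
      ext <;> simp [cmul, conj2]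
    have hB' : ∀ p ∈ Ω, dzbar α β B p = 0 := fun p hp => by
      rw [st_dzbar_congr α β (g := fun _ => 0) hΩ hB0 hp, st_dzbar_const]
    have hlin : ∀ k : ℝ × ℝ, ∀ p ∈ Ω, cmul α β (dzbar α β A p) (cmul α β k (0, -1)) +
        cmul α β (F p) (α * k.2, k.1) = 0 := by
      intro k p hp
      have h := H _ (st_cmul_contDiff α β (contDiff_const (c := k)) (stZ_contDiff p)).contDiffOn
        (fun q _ => hlin_dzbar k p q) p hp
      rw [st_key α β hΩ hp (dA p hp) (dB p hp) (dE p hp) (dF p hp) (dG p hp)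
        (hlin_diff k p p) (differentiableAt_const (cmul α β k (0, -1)))
        (fun q _ => hlin_dzbar k p q) (fun q _ => hlin_dzc k p q)] at h
      rw [hlin_conj, hlin_dzbar, (hEF p hp).1, (hEF p hp).2, hG0 p hp, hB' p hp, hB0 p hp,
        st_dzbar_const] at h
      rw [← h]
      simp only [z1, z2, add_zero, zero_add]
    have hAF : ∀ p ∈ Ω, dzbar α β A p = F p := by
      intro p hp
      rw [← sub_eq_zero]
      apply st_cmul_cancel α β (w := (0, -1)) (by simpa using hα)
      rw [← hlin (1, 0) p hp]
      ext <;> simp [cmul] <;> ring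
    have hF0 : ∀ p ∈ Ω, F p = 0 := by
      intro p hp
      have h := hlin (0, 1) p hp
      rw [hAF p hp] at h
      apply st_cmul_cancel α β (w := (2 * α, β))
        (by intro h; apply hαβ; simp only at h; linarith)
      rw [← h]
      ext
      · simp [cmul]; ring
      · simp [cmul]; ring
    exact ⟨hB0, hF0, fun p hp => ⟨dA p hp, (hAF p hp).trans (hF0 p hp)⟩,
      fun p hp => ⟨dE p hp, (hEF p hp).1⟩, fun p hp => ⟨dG p hp, hG0 p hp⟩⟩
  · rintro ⟨hB0, hF0, hA0, hE0, hG0⟩ w hw h0 p hp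
    obtain ⟨h1, h2⟩ := st_dzc_holo α β hΩ hw h0
    have dw : DifferentiableAt ℝ w p :=
      (hw.contDiffAt (hΩ.mem_nhds hp)).differentiableAt (by norm_num)
    have hB' : dzbar α β B p = 0 := by
      rw [st_dzbar_congr α β (g := fun _ => 0) hΩ hB0 hp, st_dzbar_const]
    have hF' : dzbar α β F p = 0 := by
      rw [st_dzbar_congr α β (g := fun _ => 0) hΩ hF0 hp, st_dzbar_const]
    rw [st_key α β hΩ hp (dA p hp) (dB p hp) (dE p hp) (dF p hp) (dG p hp) dw (h2 p hp).1 h0 h1,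
      hB', hF', (hA0 p hp).2, (hE0 p hp).2, (hG0 p hp).2, hB0 p hp, hF0 p hp, (h2 p hp).2,
      h0 p hp]
    simp only [z1, z2, add_zero]
end
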